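/- Let H be a nonempty set, let I be a fine ideal on P_{ω1}(H), and let f : P_{ω1}(H) → Ordinals. Let ⟨B_n : n < ω⟩ be a sequence of pairwise disjoint members of I⁺ and let B := ⋃_{n<ω} B_n. Let ⟨f_n : n < ω⟩ be ordinal-valued functions on P_{ω1}(H) such that f_n ≤_{I+B_n} f for every n < ω. Then B ∈ I⁺ and rk_{I+B}(f) ≥ min{rk_{I+B_n}(f_n) : n < ω}. -/

import Mathlib

namespace Galvin

/-- `P_{ω₁}(H)`: the collection of countable subsets of `H`. -/
def Pom (H : Type u) : Set (Set H) := {M : Set H | M.Countable}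

/-- An ideal on `P_{ω₁}(H)`: a proper collection of subsets of `P_{ω₁}(H)` closed under
subsets and finite unions. -/
structure IsIdeal (H : Type u) (I : Set (Set (Set H))) : Prop where
  subset_pom : ∀ A ∈ I, A ⊆ Pom H
  empty_mem : (∅ : Set (Set H)) ∈ I
  subset_mem : ∀ A ∈ I, ∀ B : Set (Set H), B ⊆ A → B ∈ I
  union_mem : ∀ A ∈ I, ∀ B ∈ I, A ∪ B ∈ I
  proper : Pom H ∉ I

/-- ℵ₁-completeness: closure under countable unions. -/
def IsComplete {H : Type u} (I : Set (Set (Set H))) : Prop :=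
  ∀ A : ℕ → Set (Set H), (∀ n, A n ∈ I) → (⋃ n, A n) ∈ I

/-- A fine ideal: an ℵ₁-complete ideal containing `{M : x ∉ M}` for every `x ∈ H`. -/
def IsFineIdeal (H : Type u) (I : Set (Set (Set H))) : Prop :=
  IsIdeal H I ∧ IsComplete I ∧ ∀ x : H, {M ∈ Pom H | x ∉ M} ∈ I

/-- Normality: closure under diagonal unions. -/
def IsNormal (H : Type u) (I : Set (Set (Set H))) : Prop :=
  ∀ A : H → Set (Set H), (∀ x, A x ∈ I) → {M ∈ Pom H | ∃ x ∈ M, M ∈ A x} ∈ I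

/-- `I⁺`: the `I`-positive subsets of `P_{ω₁}(H)`. -/
def pos (H : Type u) (I : Set (Set (Set H))) : Set (Set (Set H)) :=
  {A | A ⊆ Pom H ∧ A ∉ I}

/-- `I*`: the dual filter of `I`. -/
def star (H : Type u) (I : Set (Set (Set H))) : Set (Set (Set H)) :=
  {A | Pom H \ A ∈ I}

/-- `I + A`: the ideal `{B : B ∩ A ∈ I}`. -/
def add (H : Type u) (I : Set (Set (Set H))) (A : Set (Set H)) : Set (Set (Set H)) :=
  {B | B ⊆ Pom H ∧ B ∩ A ∈ I}

end Galvin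
namespace Galvin

/-- `f <_I g`: `f` is less than `g` modulo the ideal `I`. -/
def ltIdeal (H : Type u) (I : Set (Set (Set H))) (f g : Set H → Ordinal.{v}) : Prop :=
  {M ∈ Pom H | ¬ f M < g M} ∈ I

/-- `f ≤_I g`: `f` is at most `g` modulo the ideal `I`. -/
def leIdeal (H : Type u) (I : Set (Set (Set H))) (f g : Set H → Ordinal.{v}) : Prop :=
  {M ∈ Pom H | ¬ f M ≤ g M} ∈ I

/-- `rk_I(f)`: the rank of `f` in the relation `<_I` (which is well-founded whenever `I` is
ℵ₁-complete); junk value `0` in the degenerate non-well-founded case. -/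
noncomputable def rk (H : Type u) (I : Set (Set (Set H))) (f : Set H → Ordinal.{v}) :
    Ordinal :=
  letI := Classical.dec (WellFounded (ltIdeal.{u, v} H I))
  if h : WellFounded (ltIdeal.{u, v} H I) then (h.apply f).rank else 0

end Galvin

namespace Galvin

theorem wellFounded_ltIdeal_add {H : Type u} {I : Set (Set (Set H))} (hI : IsIdeal H I)
    (hc : IsComplete I) {A : Set (Set H)} (hA : A ∈ pos H I) :
    WellFounded (ltIdeal.{u, v} H (add H I A)) := by
  rw [wellFounded_iff_isEmpty_descending_chain]
  refine ⟨fun ⟨s, hs⟩ => hA.2 (hI.subset_mem _ (hc _ fun n => (hs n).2) A fun M hM => ?_)⟩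
  by_contra hbad
  have hlt : ∀ n, s (n + 1) M < s n M := fun n => by
    by_contra hn
    exact hbad (Set.mem_iUnion.2 ⟨n, ⟨hA.1 hM, hn⟩, hM⟩)
  exact (wellFounded_iff_isEmpty_descending_chain.1
    (wellFounded_lt (α := Ordinal.{v}))).false ⟨fun n => s n M, hlt⟩

theorem lt_rk_iff {H : Type u} {I : Set (Set (Set H))}
    (hwf : WellFounded (ltIdeal.{u, v} H I)) {f : Set H → Ordinal.{v}} {o : Ordinal} :
    o < rk H I f ↔ ∃ h, ltIdeal H I h f ∧ o ≤ rk H I h := by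
  have hrk : ∀ k, rk H I k = (hwf.apply k).rank := fun k => dif_pos hwf
  simp only [hrk, Acc.rank_eq (hwf.apply f), Ordinal.lt_iSup_iff, Order.lt_succ_iff,
    Subtype.exists]
  exact ⟨fun ⟨h, hf, ho⟩ => ⟨h, hf, ho⟩, fun ⟨h, hf, ho⟩ => ⟨h, hf, ho⟩⟩

theorem iUnion_mem_pos {H : Type u} {I : Set (Set (Set H))} (hI : IsIdeal H I)
    {B : ℕ → Set (Set H)} (hB : ∀ n, B n ∈ pos H I) : (⋃ n, B n) ∈ pos H I :=
  ⟨Set.iUnion_subset fun n => (hB n).1,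
    fun h => (hB 0).2 (hI.subset_mem _ h _ (Set.subset_iUnion B 0))⟩

/-- Functions on the pieces of a countable disjoint family can be glued to a function that
agrees with each of them on its piece. -/
theorem exists_glue {α β : Type*} [Nonempty β] {B : ℕ → Set α}
    (hB : ∀ m n, m ≠ n → Disjoint (B m) (B n)) (h : ℕ → α → β) :
    ∃ k : α → β, ∀ n, ∀ x ∈ B n, k x = h n x := by
  classical
  refine ⟨fun x => if hx : ∃ n, x ∈ B n then h hx.choose x else Classical.arbitrary β,
    fun n x hx => ?_⟩
  have hex : ∃ n, x ∈ B n := ⟨n, hx⟩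
  have hn : hex.choose = n := by
    by_contra hne
    exact Set.disjoint_left.1 (hB _ _ hne) hex.choose_spec hx
  simp only [dif_pos hex, hn]

theorem le_rk_add_iUnion {H : Type u} {I : Set (Set (Set H))} (hI : IsIdeal H I)
    (hc : IsComplete I) {B : ℕ → Set (Set H)} (hBpos : ∀ n, B n ∈ pos H I)
    (hBdisj : ∀ m n, m ≠ n → Disjoint (B m) (B n)) (o : Ordinal) :
    ∀ (f : Set H → Ordinal.{v}) (g : ℕ → Set H → Ordinal.{v}),
      (∀ n, leIdeal H (add H I (B n)) (g n) f) → (∀ n, o ≤ rk H (add H I (B n)) (g n)) →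
      o ≤ rk H (add H I (⋃ n, B n)) f := by
  induction o using WellFoundedLT.induction with
  | ind o ih =>
    intro f g hg ho
    refine le_of_forall_lt fun b hb => ?_
    choose h hhg hbh using fun n =>
      (lt_rk_iff (wellFounded_ltIdeal_add hI hc (hBpos n))).1 (hb.trans_le (ho n))
    obtain ⟨k, hk⟩ := exists_glue hBdisj h
    refine (lt_rk_iff (wellFounded_ltIdeal_add hI hc (iUnion_mem_pos hI hBpos))).2
      ⟨k, ⟨Set.sep_subset _ _, ?_⟩, ih b hb k h (fun n => ⟨Set.sep_subset _ _, ?_⟩) hbh⟩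
    · refine hI.subset_mem _ (hc _ fun n => hI.union_mem _ (hhg n).2 _ (hg n).2) _ ?_
      rintro M ⟨⟨hM, hkf⟩, hMB⟩
      obtain ⟨n, hn⟩ := Set.mem_iUnion.1 hMB
      refine Set.mem_iUnion.2 ⟨n, ?_⟩
      by_cases hlt : h n M < g n M
      · refine Or.inr ⟨⟨hM, fun hle => hkf ?_⟩, hn⟩
        rw [hk n M hn]
        exact hlt.trans_le hle
      · exact Or.inl ⟨⟨hM, hlt⟩, hn⟩
    · refine hI.subset_mem _ hI.empty_mem _ ?_
      rintro M ⟨⟨-, hne⟩, hn⟩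
      exact hne (hk n M hn).ge

/-- The first claim in Lemma 3.7: for pairwise disjoint `I`-positive sets `Bₙ` with union `B`
and functions `fₙ ≤_{I+Bₙ} f`, the union `B` is `I`-positive and
`rk_{I+B}(f) ≥ min_n rk_{I+Bₙ}(fₙ)`. -/
theorem rank_union_ge_min {H : Type u} [Nonempty H] (I : Set (Set (Set H)))
    (hI : IsFineIdeal H I) (f : Set H → Ordinal.{v})
    (B : ℕ → Set (Set H)) (hBpos : ∀ n, B n ∈ pos H I)
    (hBdisj : ∀ m n, m ≠ n → Disjoint (B m) (B n))
    (g : ℕ → Set H → Ordinal.{v})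
    (hg : ∀ n, leIdeal H (add H I (B n)) (g n) f) :
    (⋃ n, B n) ∈ pos H I ∧
      ⨅ n, rk H (add H I (B n)) (g n) ≤ rk H (add H I (⋃ n, B n)) f :=
  ⟨iUnion_mem_pos hI.1 hBpos, le_rk_add_iUnion hI.1 hI.2.1 hBpos hBdisj _ f g hg
    fun n => ciInf_le' _ n⟩

end Galvin
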